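/- arXiv:2605.29094 — 2 statements merged into one kernel-verified Lean document; each statement's English description precedes it below -/
import Mathlib

section
/- The derivative identity (∂/∂x - i∂/∂y) R_l^m(Z) = -(l+m)(l+m-1) R_{l-1}^{m-1}(Z) holds for the solid harmonic polynomials. -/
/-- The associated Legendre polynomial
`P_l^m(x) = ((-1)^m / (2^l l!)) (1-x^2)^{m/2} d^{l+m}/dx^{l+m} [(x^2-1)^l]`. -/
noncomputable def assocLegendre (l : ℕ) (m : ℤ) (x : ℝ) : ℝ :=
  ((-1 : ℝ) ^ m / (2 ^ l * (Nat.factorial l : ℝ))) * (1 - x ^ 2) ^ ((m : ℝ) / 2) *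
    iteratedDeriv ((l : ℤ) + m).toNat (fun y : ℝ => (y ^ 2 - 1) ^ l) x

/-- The solid harmonic polynomial `R_l^m(Z) = r^l P_l^m(cos θ) e^{imφ}`, written in the
Cartesian coordinates `(x, y, t) ∈ ℝ³` (with `z = x + iy = r sin θ e^{iφ}`, `t = r cos θ`):
`R_l^m = (x²+y²+t²)^{l/2} · ((x+iy)/√(x²+y²))^m · P_l^m(t/√(x²+y²+t²))`. -/
noncomputable def solidHarmonic (l : ℕ) (m : ℤ) (x y t : ℝ) : ℂ :=
  ((Real.sqrt (x ^ 2 + y ^ 2 + t ^ 2) : ℂ) ^ l) *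
    (((x : ℂ) + (y : ℂ) * Complex.I) / (Real.sqrt (x ^ 2 + y ^ 2) : ℂ)) ^ m *
    ((assocLegendre l m (t / Real.sqrt (x ^ 2 + y ^ 2 + t ^ 2)) : ℝ) : ℂ)

open Polynomial

/-- The quadratic `-w̄ + 2 t g + w g²` in `g`, with `w = x + iy`; the coefficients of its powers
are, up to normalization, the solid harmonics. -/
noncomputable def solidHarmonicGen (x y t : ℝ) : ℂ[X] :=
  C (-((x : ℂ) - y * Complex.I)) + C (2 * (t : ℂ)) * X + C ((x : ℂ) + y * Complex.I) * X ^ 2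

theorem iteratedDeriv_polynomial_eval (p : ℝ[X]) (k : ℕ) :
    iteratedDeriv k (fun y => p.eval y) = fun y => (derivative^[k] p).eval y := by
  induction k with
  | zero => simp
  | succ k ih =>
    rw [iteratedDeriv_succ, ih]
    funext y
    rw [Polynomial.deriv, Function.iterate_succ_apply']

theorem iteratedDeriv_sq_sub_one_pow (l k : ℕ) (u : ℝ) :
    iteratedDeriv k (fun y : ℝ => (y ^ 2 - 1) ^ l) u =
      k.factorial * ((C (u ^ 2 - 1) + C (2 * u) * X + X ^ 2 : ℝ[X]) ^ l).coeff k := by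
  have h1 : (fun y : ℝ => (y ^ 2 - 1) ^ l) = fun y => ((X ^ 2 - 1 : ℝ[X]) ^ l).eval y := by
    funext y; simp
  have h2 : (C (u ^ 2 - 1) + C (2 * u) * X + X ^ 2 : ℝ[X]) ^ l =
      taylor u ((X ^ 2 - 1 : ℝ[X]) ^ l) := by
    rw [taylor_apply]
    simp only [pow_comp, sub_comp, X_comp, one_comp, map_sub, map_pow, map_mul, map_one]
    congr 1
    rw [show (C 2 : ℝ[X]) = 2 from rfl]
    ring
  rw [h1, iteratedDeriv_polynomial_eval, h2, taylor_coeff, ← factorial_smul_hasseDeriv]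
  simp

theorem coeff_solidHarmonicGen_pow_mul {x y t r u : ℝ} {a : ℂ}
    (hG : C (r : ℂ) * ((C (u ^ 2 - 1) + C (2 * u) * X + X ^ 2 : ℝ[X]).map Complex.ofRealHom).comp
      (C a * X) = C a * solidHarmonicGen x y t) (l k : ℕ) :
    (r : ℂ) ^ l * ((((C (u ^ 2 - 1) + C (2 * u) * X + X ^ 2 : ℝ[X]) ^ l).coeff k : ℝ) : ℂ) * a ^ k =
      a ^ l * (solidHarmonicGen x y t ^ l).coeff k := by
  have h := congrArg (fun p => (p ^ l).coeff k) hG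
  simp only [mul_pow, ← C_pow, coeff_C_mul, ← pow_comp, ← Polynomial.map_pow,
    comp_C_mul_X_coeff, coeff_map] at h
  rw [← h]
  simp [mul_assoc]

theorem solidHarmonic_eq_coeff (l k : ℕ) (m : ℤ) (hk : (k : ℤ) = l + m) (x y t : ℝ) :
    solidHarmonic l m x y t =
      (-1) ^ m * k.factorial / (2 ^ l * l.factorial) *
        (solidHarmonicGen x y t ^ l).coeff k := by
  unfold solidHarmonic assocLegendre
  rw [← hk, Int.toNat_natCast, iteratedDeriv_sq_sub_one_pow]
  obtain rfl : m = (k : ℤ) - l := by omega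
  by_cases h0 : x ^ 2 + y ^ 2 = 0
  · obtain rfl : x = 0 := by nlinarith [sq_nonneg x, sq_nonneg y]
    obtain rfl : y = 0 := by nlinarith [sq_nonneg y]
    have hF : solidHarmonicGen 0 0 t = C (2 * (t : ℂ)) * X := by simp [solidHarmonicGen]
    rw [hF, mul_pow, ← C_pow, coeff_C_mul, coeff_X_pow]
    by_cases hkl : k = l
    · subst hkl
      by_cases ht : t = 0
      · subst ht
        rcases Nat.eq_zero_or_pos k with rfl | hpos
        · simp
        · simp [hpos.ne']
      · have hs : √(t ^ 2) ≠ 0 := by positivity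
        have hu2 : (t / √(t ^ 2)) ^ 2 - 1 = 0 := by
          rw [div_pow, Real.sq_sqrt (sq_nonneg t), div_self (by positivity), sub_self]
        have hG : ((C ((t / √(t ^ 2)) ^ 2 - 1) + C (2 * (t / √(t ^ 2))) * X + X ^ 2 : ℝ[X]) ^
            k).coeff k = (2 * (t / √(t ^ 2))) ^ k := by
          rw [hu2, C_0, zero_add, sq X, ← add_mul, mul_pow, coeff_mul_X_pow', if_pos le_rfl,
            Nat.sub_self, coeff_zero_eq_eval_zero]
          simp
        have hz : (0 : ℝ) ^ 2 + 0 ^ 2 + t ^ 2 = t ^ 2 := by ring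
        have hs' : ((√(t ^ 2) : ℝ) : ℂ) ≠ 0 := by exact_mod_cast hs
        rw [hz, hG]
        simp only [sub_self, zpow_zero, Int.cast_zero, zero_div, Real.rpow_zero, if_true]
        have hfac : (k.factorial : ℂ) ≠ 0 := by exact_mod_cast k.factorial_ne_zero
        push_cast
        rw [mul_pow, mul_pow, div_pow]
        field_simp
    · have : ((k : ℤ) - l) ≠ 0 := by omega
      simp [hkl, zero_zpow _ this]
  · have hpos : 0 < x ^ 2 + y ^ 2 := lt_of_le_of_ne (by positivity) (Ne.symm h0)
    have hpos' : 0 < x ^ 2 + y ^ 2 + t ^ 2 := by positivity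
    have hs : 0 < √(x ^ 2 + y ^ 2) := Real.sqrt_pos.2 hpos
    have hr : 0 < √(x ^ 2 + y ^ 2 + t ^ 2) := Real.sqrt_pos.2 hpos'
    have hs2 := Real.sq_sqrt hpos.le
    have hr2 := Real.sq_sqrt hpos'.le
    set s := √(x ^ 2 + y ^ 2)
    set r := √(x ^ 2 + y ^ 2 + t ^ 2)
    have hsC : (s : ℂ) ≠ 0 := by exact_mod_cast hs.ne'
    have hrC : (r : ℂ) ≠ 0 := by exact_mod_cast hr.ne'
    have hww : ((x : ℂ) + y * Complex.I) * (x - y * Complex.I) = s ^ 2 := by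
      have : (s : ℂ) ^ 2 = x ^ 2 + y ^ 2 := by exact_mod_cast hs2
      rw [this]
      linear_combination -(y : ℂ) ^ 2 * Complex.I_sq
    have hw : (x : ℂ) + y * Complex.I ≠ 0 := by
      intro h
      rw [h, zero_mul] at hww
      exact pow_ne_zero 2 hsC hww.symm
    have hc : 1 - (t / r) ^ 2 = (s / r) ^ 2 := by
      field_simp
      linarith
    have hcm : (1 - (t / r) ^ 2) ^ ((((k : ℤ) - l : ℤ) : ℝ) / 2) = (s / r) ^ ((k : ℤ) - l) := by
      rw [hc, ← Real.rpow_natCast, ← Real.rpow_mul (by positivity), ← Real.rpow_intCast]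
      congr 1
      push_cast
      ring
    have key := coeff_solidHarmonicGen_pow_mul (x := x) (y := y) (t := t) (r := r) (u := t / r)
      (a := ((x : ℂ) + y * Complex.I) / r) (by
        have hc' : ((t : ℂ) / r) ^ 2 - 1 = -((s / r) ^ 2) := by
          have : ((1 - (t / r) ^ 2 : ℝ) : ℂ) = ((s / r) ^ 2 : ℝ) := by rw [hc]
          push_cast at this
          linear_combination -this
        simp only [Polynomial.map_add, Polynomial.map_mul, Polynomial.map_pow, map_C, map_X,
          add_comp, mul_comp, C_comp, X_comp, pow_comp, solidHarmonicGen, Complex.ofRealHom_eq_coe]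
        push_cast
        rw [hc', div_pow, ← hww]
        simp only [mul_add, mul_pow, ← mul_assoc, ← C_mul, ← C_pow]
        congr 1
        · congr 1
          · congr 1
            field_simp
          · congr 2
            field_simp
        · congr 2
          field_simp) l k
    rw [hcm]
    have ha : ((x : ℂ) + y * Complex.I) / r ≠ 0 := div_ne_zero hw hrC
    have hF : (solidHarmonicGen x y t ^ l).coeff k = (r : ℂ) ^ l *
        ((((C ((t / r) ^ 2 - 1) + C (2 * (t / r)) * X + X ^ 2 : ℝ[X]) ^ l).coeff k : ℝ) : ℂ) *
          (((x : ℂ) + y * Complex.I) / r) ^ ((k : ℤ) - l) := by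
      rw [zpow_sub₀ ha, zpow_natCast, zpow_natCast, ← mul_div_assoc, key,
        mul_div_cancel_left₀ _ (pow_ne_zero l ha)]
    have he : ((x : ℂ) + y * Complex.I) / r = (((x : ℂ) + y * Complex.I) / s) * (s / r) := by
      field_simp
    rw [hF, he, mul_zpow]
    push_cast
    ring

theorem hasDerivAt_coeff_pow {P : ℝ → ℂ[X]} {P' : ℂ[X]} {x : ℝ}
    (hP : ∀ k, HasDerivAt (fun x => (P x).coeff k) (P'.coeff k) x) (l k : ℕ) :
    HasDerivAt (fun x => (P x ^ l).coeff k) ((l * P x ^ (l - 1) * P').coeff k) x := by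
  induction l generalizing k with
  | zero => simpa using hasDerivAt_const x ((1 : ℂ[X]).coeff k)
  | succ l ih =>
    have h : ((l + 1 : ℕ) * P x ^ (l + 1 - 1) * P' : ℂ[X]) =
        (l * P x ^ (l - 1) * P') * P x + P x ^ l * P' := by
      cases l with
      | zero => simp
      | succ l => simp only [Nat.add_sub_cancel]; push_cast; ring
    rw [h, coeff_add, coeff_mul, coeff_mul _ P', ← Finset.sum_add_distrib]
    simp only [pow_succ, coeff_mul (P _ ^ l)]
    exact HasDerivAt.fun_sum fun i _ => (ih i.1).fun_mul (hP i.2)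

theorem hasDerivAt_coeff_quadratic {A B : ℝ → ℂ} {A' B' : ℂ} {x : ℝ} (hA : HasDerivAt A A' x)
    (hB : HasDerivAt B B' x) (b : ℂ) (k : ℕ) :
    HasDerivAt (fun x => (C (A x) + C b * X + C (B x) * X ^ 2 : ℂ[X]).coeff k)
      ((C A' + C B' * X ^ 2 : ℂ[X]).coeff k) x := by
  have hC : ∀ a : ℂ, (C a).coeff k = a * (1 : ℂ[X]).coeff k := fun a => by
    rw [← coeff_C_mul, mul_one]
  simp only [coeff_add, coeff_C_mul, hC]
  exact ((hA.mul_const _).add_const _).fun_add (hB.mul_const _)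

theorem hasDerivAt_coeff_solidHarmonicGen_fst (x y t : ℝ) (k : ℕ) :
    HasDerivAt (fun x' => (solidHarmonicGen x' y t).coeff k)
      ((C (-1) + C 1 * X ^ 2 : ℂ[X]).coeff k) x := by
  have h : HasDerivAt (fun x : ℝ => (x : ℂ)) 1 x := by
    simpa using (hasDerivAt_id x).ofReal_comp
  exact hasDerivAt_coeff_quadratic (h.sub_const _).fun_neg (h.add_const _) _ k

theorem hasDerivAt_coeff_solidHarmonicGen_snd (x y t : ℝ) (k : ℕ) :
    HasDerivAt (fun y' => (solidHarmonicGen x y' t).coeff k)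
      ((C Complex.I + C Complex.I * X ^ 2 : ℂ[X]).coeff k) y := by
  have h : HasDerivAt (fun y : ℝ => (y : ℂ) * Complex.I) Complex.I y := by
    simpa using (hasDerivAt_id y).ofReal_comp.mul_const Complex.I
  have hA := (h.const_sub (x : ℂ)).fun_neg
  rw [neg_neg] at hA
  exact hasDerivAt_coeff_quadratic hA (h.const_add _) _ k

/-- The derivative identity
`(∂/∂x - i ∂/∂y) R_l^m(Z) = -(l+m)(l+m-1) R_{l-1}^{m-1}(Z)` for solid harmonics. -/
theorem solidHarmonic_deriv_lower (l : ℕ) (m : ℤ) (h1 : -(l : ℤ) ≤ m) (h2 : m ≤ (l : ℤ))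
    (x y t : ℝ) :
    deriv (fun x' : ℝ => solidHarmonic l m x' y t) x -
        Complex.I * deriv (fun y' : ℝ => solidHarmonic l m x y' t) y =
      -((((l : ℝ) + (m : ℝ)) * ((l : ℝ) + (m : ℝ) - 1) : ℝ) : ℂ) *
        solidHarmonic (l - 1) (m - 1) x y t := by
  obtain ⟨k, hk⟩ := Int.eq_ofNat_of_zero_le (show 0 ≤ (l : ℤ) + m by omega)
  have hkR : (l : ℝ) + m = k := by exact_mod_cast hk
  simp only [solidHarmonic_eq_coeff l k m hk.symm]
  rw [((hasDerivAt_coeff_pow (hasDerivAt_coeff_solidHarmonicGen_fst x y t) l k).const_mul _).deriv,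
    ((hasDerivAt_coeff_pow (hasDerivAt_coeff_solidHarmonicGen_snd x y t) l k).const_mul _).deriv,
    mul_left_comm, ← mul_sub, ← coeff_C_mul, ← coeff_sub]
  have hII : (C Complex.I * C Complex.I : ℂ[X]) = -1 := by
    rw [← C_mul, Complex.I_mul_I, C_neg, C_1]
  have hP : ((l : ℂ[X]) * solidHarmonicGen x y t ^ (l - 1) * (C (-1) + C 1 * X ^ 2) -
      C Complex.I * ((l : ℂ[X]) * solidHarmonicGen x y t ^ (l - 1) *
        (C Complex.I + C Complex.I * X ^ 2))) =
      C (2 * (l : ℂ)) * (solidHarmonicGen x y t ^ (l - 1) * X ^ 2) := by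
    rw [C_mul, C_neg, C_1, show (C 2 : ℂ[X]) = 2 from rfl, C_eq_natCast]
    linear_combination -((l : ℂ[X]) * solidHarmonicGen x y t ^ (l - 1) * (1 + X ^ 2)) * hII
  rw [hP, coeff_C_mul, coeff_mul_X_pow', hkR]
  split_ifs with hk2
  · obtain ⟨j, rfl⟩ := Nat.exists_eq_add_of_le' hk2
    obtain ⟨n, rfl⟩ := Nat.exists_eq_add_of_le' (show 1 ≤ l by omega)
    rw [solidHarmonic_eq_coeff (n + 1 - 1) j (m - 1) (by push_cast at hk ⊢; omega)]
    simp only [Nat.add_sub_cancel, Nat.factorial_succ]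
    rw [zpow_sub_one₀ (by norm_num)]
    have : (n.factorial : ℂ) ≠ 0 := by exact_mod_cast n.factorial_ne_zero
    have : (n + 1 : ℂ) ≠ 0 := by exact_mod_cast n.succ_ne_zero
    push_cast
    field_simp
    ring
  · have : k = 0 ∨ k = 1 := by omega
    rcases this with rfl | rfl <;> simp
end

section
/- The real span of the normally-ordered quadratic operators :a_k a*_l: = (1/2)(a_k a*_l + a*_l a_k), 1 ≤ k, l ≤ 2r, acting on Laurent polynomials, is closed under commutator and forms a real Lie algebra isomorphic to gl(2r, ℝ). -/
/-- The space of Laurent polynomials in `n` variables, encoded by finitely supported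
coefficient functions on the monomial exponents `Fin n → ℤ`. -/
abbrev LaurentW (n : ℕ) := (Fin n → ℤ) →₀ ℂ

/-- Multiplication by the `k`-th variable, as a linear operator on Laurent polynomials. -/
noncomputable def mulVar (n : ℕ) (k : Fin n) : Module.End ℂ (LaurentW n) :=
  Finsupp.lmapDomain ℂ ℂ (fun α => α + Pi.single k 1)

/-- Differentiation with respect to the `k`-th variable, as a linear operator on Laurent
polynomials: it sends the monomial `w^α` to `α k · w^{α - e_k}`. -/
noncomputable def derivVar (n : ℕ) (k : Fin n) : Module.End ℂ (LaurentW n) :=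
  Finsupp.lsum ℂ fun α : Fin n → ℤ =>
    ((α k : ℂ)) • Finsupp.lsingle (R := ℂ) (α - Pi.single k 1)

/-- The operator `a_k`. -/
noncomputable def annOp (r : ℕ) (k : Fin (2 * r)) : Module.End ℂ (LaurentW (2 * r)) :=
  if (k : ℕ) < r then mulVar (2 * r) k else derivVar (2 * r) k

/-- The operator `a*_k`. -/
noncomputable def creOp (r : ℕ) (k : Fin (2 * r)) : Module.End ℂ (LaurentW (2 * r)) :=
  if (k : ℕ) < r then derivVar (2 * r) k else mulVar (2 * r) k

/-- The normally-ordered quadratic operator `:a_k a*_l: = (1/2)(a_k a*_l + a*_l a_k)`. -/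
noncomputable def quadOp (r : ℕ) (k l : Fin (2 * r)) : Module.End ℂ (LaurentW (2 * r)) :=
  (1 / 2 : ℂ) • (annOp r k * creOp r l + creOp r l * annOp r k)

section CanonicalCommutation

variable {K R ι : Type*} [Field K] [Ring R] [Algebra K R]

attribute [local instance] LieRing.ofAssociativeRing

/-- Families `a`, `c` satisfying canonical commutation relations with signs `ε`. -/
structure IsCanonicalPair [DecidableEq ι] (ε : ι → K) (a c : ι → R) : Prop where
  sign_mul_self : ∀ k, ε k * ε k = 1
  lie_left : ∀ k l, ⁅a k, a l⁆ = 0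
  lie_right : ∀ k l, ⁅c k, c l⁆ = 0
  lie_left_right : ∀ k l, ⁅a k, c l⁆ = if k = l then ε k • 1 else 0

/-- The symmetrized product. -/
def symmProd (K : Type*) [Field K] [Algebra K R] (x y : R) : R :=
  (2 : K)⁻¹ • (x * y + y * x)

theorem Ring.lie_algebra_smul (t : K) (x y : R) : ⁅x, t • y⁆ = t • ⁅x, y⁆ := by
  simp only [Ring.lie_def, mul_smul_comm, smul_mul_assoc, smul_sub]

theorem Ring.lie_eq_neg_lie (x y : R) : ⁅x, y⁆ = -⁅y, x⁆ := by
  simp only [Ring.lie_def, neg_sub]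

theorem lie_symmProd (z x y : R) :
    ⁅z, symmProd K x y⁆ = symmProd K ⁅z, x⁆ y + symmProd K x ⁅z, y⁆ := by
  simp only [symmProd, Ring.lie_algebra_smul, ← smul_add]
  congr 1
  simp only [Ring.lie_def]
  noncomm_ring

theorem symmProd_zero_left (y : R) : symmProd K 0 y = 0 := by simp [symmProd]

theorem symmProd_zero_right (x : R) : symmProd K x 0 = 0 := by simp [symmProd]

theorem symmProd_smul_left (t : K) (x y : R) : symmProd K (t • x) y = t • symmProd K x y := by
  simp only [symmProd, smul_mul_assoc, mul_smul_comm, ← smul_add, smul_comm t]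

theorem symmProd_smul_right (t : K) (x y : R) : symmProd K x (t • y) = t • symmProd K x y := by
  simp only [symmProd, smul_mul_assoc, mul_smul_comm, ← smul_add, smul_comm t]

namespace IsCanonicalPair

variable {ε : ι → K} {a c : ι → R}

/-- The image of the matrix unit `E_{kl}` in the quadratic operators. -/
def unitImage (ε : ι → K) (a c : ι → R) (k l : ι) : R :=
  -ε l • symmProd K (a k) (c l)

variable [Fintype ι]

/-- The linear map from matrices to quadratic operators sending `E_{kl}` to `unitImage k l`. -/
def matrixMap (ε : ι → K) (a c : ι → R) : Matrix ι ι K →ₗ[K] R :=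
  ∑ k, ∑ l, (Matrix.entryLinearMap K K k l).smulRight (unitImage ε a c k l)

theorem matrixMap_apply (A : Matrix ι ι K) :
    matrixMap ε a c A = ∑ k, ∑ l, A k l • unitImage ε a c k l := by
  simp [matrixMap, LinearMap.sum_apply]

variable [DecidableEq ι]

theorem matrixMap_single (k l : ι) (t : K) :
    matrixMap ε a c (Matrix.single k l t) = t • unitImage ε a c k l := by
  simp [matrixMap_apply, Matrix.single_apply, ite_and, ite_smul]

theorem range_matrixMap (h : IsCanonicalPair ε a c) :
    LinearMap.range (matrixMap ε a c) =
      Submodule.span K (Set.range fun p : ι × ι => symmProd K (a p.1) (c p.2)) := by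
  apply le_antisymm
  · rintro _ ⟨A, rfl⟩
    rw [matrixMap_apply]
    exact Submodule.sum_mem _ fun k _ => Submodule.sum_mem _ fun l _ =>
      Submodule.smul_mem _ _ (Submodule.smul_mem _ _ (Submodule.subset_span ⟨(k, l), rfl⟩))
  · rw [Submodule.span_le]
    rintro _ ⟨⟨k, l⟩, rfl⟩
    refine ⟨Matrix.single k l (-ε l), ?_⟩
    simp [matrixMap_single, unitImage, smul_smul, h.sign_mul_self]

end IsCanonicalPair

variable [NeZero (2 : K)]

theorem symmProd_one_right (x : R) : symmProd K x 1 = x := by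
  rw [symmProd, mul_one, one_mul, ← two_smul K x, smul_smul,
    inv_mul_cancel₀ (NeZero.ne (2 : K)), one_smul]

theorem symmProd_one_left (x : R) : symmProd K 1 x = x := by
  rw [symmProd, add_comm]
  exact symmProd_one_right x

namespace IsCanonicalPair

variable [DecidableEq ι] {ε : ι → K} {a c : ι → R}

theorem lie_symmProd_left (h : IsCanonicalPair ε a c) (k l m : ι) :
    ⁅symmProd K (a k) (c l), a m⁆ = if l = m then -(ε l • a k) else 0 := by
  rw [Ring.lie_eq_neg_lie, lie_symmProd, h.lie_left, h.lie_left_right,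
    symmProd_zero_left, zero_add]
  by_cases hlm : l = m
  · subst hlm
    simp [symmProd_smul_right, symmProd_one_right]
  · simp [hlm, Ne.symm hlm, symmProd_zero_right]

theorem lie_symmProd_right (h : IsCanonicalPair ε a c) (k l m : ι) :
    ⁅symmProd K (a k) (c l), c m⁆ = if k = m then ε k • c l else 0 := by
  rw [Ring.lie_eq_neg_lie, lie_symmProd, h.lie_right, Ring.lie_eq_neg_lie, h.lie_left_right,
    symmProd_zero_right, add_zero]
  by_cases hkm : k = m
  · subst hkm
    simp only [if_true, ← neg_smul, symmProd_smul_left, symmProd_one_left, neg_neg]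
  · simp [hkm, symmProd_zero_left]

theorem lie_unitImage_left (h : IsCanonicalPair ε a c) (k l m : ι) :
    ⁅unitImage ε a c k l, a m⁆ = if l = m then a k else 0 := by
  rw [unitImage, smul_lie, h.lie_symmProd_left]
  split_ifs <;> simp [smul_smul, h.sign_mul_self]

theorem lie_unitImage_unitImage (h : IsCanonicalPair ε a c) (k l m n : ι) :
    ⁅unitImage ε a c k l, unitImage ε a c m n⁆ =
      (if l = m then unitImage ε a c k n else 0) -
        if n = k then unitImage ε a c m l else 0 := by
  conv_lhs => rw [unitImage.eq_def ε a c m n, Ring.lie_algebra_smul, lie_symmProd,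
    h.lie_unitImage_left, unitImage, smul_lie, h.lie_symmProd_right]
  rw [smul_add, sub_eq_add_neg]
  congr 1
  · split_ifs <;> simp [unitImage, symmProd_zero_left]
  · by_cases hkn : k = n
    · subst hkn
      simp only [if_true, symmProd_smul_right, unitImage, smul_smul, ← neg_smul]
      congr 1
      linear_combination ε l * h.sign_mul_self k
    · simp [hkn, Ne.symm hkn, symmProd_zero_right]

variable [Fintype ι]

theorem matrixMap_commutator (h : IsCanonicalPair ε a c) (A B : Matrix ι ι K) :
    matrixMap ε a c (A * B - B * A) = ⁅matrixMap ε a c A, matrixMap ε a c B⁆ := by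
  induction A using Matrix.induction_on' with
  | h_zero => simp
  | h_add A A' hA hA' =>
    rw [map_add, add_lie, ← hA, ← hA', ← map_add]
    congr 1
    noncomm_ring
  | h_std_basis k l s =>
    induction B using Matrix.induction_on' with
    | h_zero => simp
    | h_add B B' hB hB' =>
      rw [map_add, lie_add, ← hB, ← hB', ← map_add]
      congr 1
      noncomm_ring
    | h_std_basis m n t =>
      simp only [matrixMap_single, smul_lie, Ring.lie_algebra_smul, h.lie_unitImage_unitImage,
        map_sub, smul_sub, smul_ite, smul_zero]
      congr 1
      · split_ifs with hlm
        · subst hlm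
          rw [Matrix.single_mul_single_same, matrixMap_single, smul_smul, mul_comm]
        · rw [Matrix.single_mul_single_of_ne _ _ _ _ hlm, map_zero]
      · split_ifs with hnk
        · subst hnk
          rw [Matrix.single_mul_single_same, matrixMap_single, smul_smul]
        · rw [Matrix.single_mul_single_of_ne _ _ _ _ hnk, map_zero]

theorem lie_lie_matrixMap (h : IsCanonicalPair ε a c) (A : Matrix ι ι K) (k m : ι) :
    ⁅⁅matrixMap ε a c A, a m⁆, c k⁆ = (A k m * ε k) • (1 : R) := by
  simp [matrixMap_apply, sum_lie, h.lie_unitImage_left, h.lie_left_right, smul_smul]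

theorem matrixMap_injective [Nontrivial R] (h : IsCanonicalPair ε a c) :
    Function.Injective (matrixMap ε a c) := by
  rw [← LinearMap.ker_eq_bot, LinearMap.ker_eq_bot']
  intro A hA
  ext k m
  have hz := h.lie_lie_matrixMap A k m
  rw [hA, zero_lie, zero_lie, eq_comm, smul_eq_zero_iff_left one_ne_zero] at hz
  exact (mul_eq_zero.mp hz).resolve_right
    (left_ne_zero_of_mul_eq_one (h.sign_mul_self k))

end IsCanonicalPair

end CanonicalCommutation

theorem mulVar_single (n : ℕ) (k : Fin n) (α : Fin n → ℤ) (z : ℂ) :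
    mulVar n k (Finsupp.single α z) = Finsupp.single (α + Pi.single k 1) z := by
  simp [mulVar]

theorem derivVar_single (n : ℕ) (k : Fin n) (α : Fin n → ℤ) (z : ℂ) :
    derivVar n k (Finsupp.single α z) = Finsupp.single (α - Pi.single k 1) (α k * z) := by
  simp [derivVar]

theorem lie_mulVar_mulVar (n : ℕ) (k l : Fin n) : ⁅mulVar n k, mulVar n l⁆ = 0 := by
  rw [Ring.lie_def, sub_eq_zero]
  refine Finsupp.lhom_ext fun α z => ?_
  simp only [Module.End.mul_apply, mulVar_single, add_right_comm]

theorem lie_derivVar_derivVar (n : ℕ) (k l : Fin n) : ⁅derivVar n k, derivVar n l⁆ = 0 := by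
  rw [Ring.lie_def, sub_eq_zero]
  refine Finsupp.lhom_ext fun α z => ?_
  simp only [Module.End.mul_apply, derivVar_single, sub_right_comm]
  congr 1
  by_cases hkl : k = l
  · subst hkl
    rfl
  · simp [hkl, Ne.symm hkl]
    ring

theorem lie_derivVar_mulVar (n : ℕ) (k l : Fin n) :
    ⁅derivVar n k, mulVar n l⁆ = if k = l then 1 else 0 := by
  rw [Ring.lie_def]
  refine Finsupp.lhom_ext fun α z => ?_
  simp only [LinearMap.sub_apply, Module.End.mul_apply, derivVar_single, mulVar_single,
    sub_add_eq_add_sub, ← Finsupp.single_sub]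
  by_cases hkl : k = l
  · subst hkl
    simp [add_mul]
  · simp [hkl]

theorem lie_mulVar_derivVar (n : ℕ) (k l : Fin n) :
    ⁅mulVar n k, derivVar n l⁆ = if k = l then -1 else 0 := by
  rw [Ring.lie_eq_neg_lie, lie_derivVar_mulVar]
  by_cases hkl : k = l
  · simp [hkl]
  · simp [hkl, Ne.symm hkl]

/-- The operators `a_k`, `a*_k` satisfy the canonical commutation relations. -/
theorem isCanonicalPair_annOp_creOp (r : ℕ) :
    IsCanonicalPair (fun k : Fin (2 * r) => if (k : ℕ) < r then (-1 : ℝ) else 1)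
      (annOp r) (creOp r) where
  sign_mul_self k := by split_ifs <;> norm_num
  lie_left k l := by
    unfold annOp
    split_ifs <;>
      simp only [lie_mulVar_mulVar, lie_derivVar_derivVar, lie_mulVar_derivVar,
        lie_derivVar_mulVar, ite_eq_right_iff] <;>
      (rintro rfl; contradiction)
  lie_right k l := by
    unfold creOp
    split_ifs <;>
      simp only [lie_mulVar_mulVar, lie_derivVar_derivVar, lie_mulVar_derivVar,
        lie_derivVar_mulVar, ite_eq_right_iff] <;>
      (rintro rfl; contradiction)
  lie_left_right k l := by
    by_cases hkl : k = l
    · subst hkl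
      unfold annOp creOp
      by_cases hk : (k : ℕ) < r
      · simp only [hk, lie_mulVar_derivVar, if_true]
        exact (neg_one_smul ℝ (1 : Module.End ℂ (LaurentW (2 * r)))).symm
      · simp [hk, lie_derivVar_mulVar]
    · unfold annOp creOp
      split_ifs <;>
        simp [lie_mulVar_mulVar, lie_derivVar_derivVar, lie_mulVar_derivVar,
          lie_derivVar_mulVar, hkl]

theorem quadOp_eq_symmProd (r : ℕ) (k l : Fin (2 * r)) :
    quadOp r k l = symmProd ℝ (annOp r k) (creOp r l) := by
  ext α β
  simp [quadOp, symmProd]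

/-- The real span of the operators `:a_k a*_l:`, `1 ≤ k, l ≤ 2r`, is closed under the
commutator, and as a real Lie algebra it is isomorphic to `gl(2r, ℝ)`. -/
theorem quadOp_span_isomorphic_gl (r : ℕ) (hr : 0 < r) :
    (∀ X ∈ Submodule.span ℝ
        (Set.range fun p : Fin (2 * r) × Fin (2 * r) => quadOp r p.1 p.2),
      ∀ Y ∈ Submodule.span ℝ
        (Set.range fun p : Fin (2 * r) × Fin (2 * r) => quadOp r p.1 p.2),
      ⁅X, Y⁆ ∈ Submodule.span ℝ
        (Set.range fun p : Fin (2 * r) × Fin (2 * r) => quadOp r p.1 p.2)) ∧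
    ∃ φ : Matrix (Fin (2 * r)) (Fin (2 * r)) ℝ →ₗ[ℝ] Module.End ℂ (LaurentW (2 * r)),
      Function.Injective φ ∧
      LinearMap.range φ = Submodule.span ℝ
        (Set.range fun p : Fin (2 * r) × Fin (2 * r) => quadOp r p.1 p.2) ∧
      ∀ A B : Matrix (Fin (2 * r)) (Fin (2 * r)) ℝ, φ (A * B - B * A) = ⁅φ A, φ B⁆ := by
  have h := isCanonicalPair_annOp_creOp r
  simp only [quadOp_eq_symmProd, ← h.range_matrixMap]
  refine ⟨?_, _, h.matrixMap_injective, rfl, h.matrixMap_commutator⟩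
  rintro _ ⟨A, rfl⟩ _ ⟨B, rfl⟩
  exact ⟨_, h.matrixMap_commutator A B⟩
end
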